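/- arXiv:1907.03973 — 3 statements merged into one kernel-verified Lean document; each statement's English description precedes it below -/
import Mathlib

section
/- Let k and l be coprime positive integers, and define F : ℂ × ℂ → ℂ⁴ by F(s, t) = (s^{k+l}, ((k−l)/(k+l))·t^{k+l}, s^l·t^k, s^k·t^l), where each coordinate is a polynomial in s and t. Then for all (s, t) ∈ ℂ², ω(∂F/∂s (s, t), ∂F/∂t (s, t)) = 0, where ∂F/∂s and ∂F/∂t are taken coordinatewise as formal partial derivatives of the polynomial coordinates. Consequently ω vanishes on the span of the two partial-derivative vectors at every point, so the degree-(k+l) rational curve parametrized by F is a contact (legendrian) curve in ℙ³. -/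
open MvPolynomial

/-- The symplectic bilinear form on `ℂ⁴` given by the matrix (2.1):
`ω(x, y) = x₀y₁ − x₁y₀ + x₂y₃ − x₃y₂`. -/
def omegaForm (x y : Fin 4 → ℂ) : ℂ :=
  x 0 * y 1 - x 1 * y 0 + x 2 * y 3 - x 3 * y 2

/-- The polynomial coordinates of the parametrization
`F(s, t) = (s^{k+l}, ((k−l)/(k+l))·t^{k+l}, s^l·t^k, s^k·t^l)` (equation (2.2)),
as bivariate polynomials in the variables `X 0 = s`, `X 1 = t`. -/
noncomputable def Fcoords (k l : ℕ) : Fin 4 → MvPolynomial (Fin 2) ℂ :=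
  ![(X 0) ^ (k + l),
    C (((k : ℂ) - (l : ℂ)) / ((k : ℂ) + (l : ℂ))) * (X 1) ^ (k + l),
    (X 0) ^ l * (X 1) ^ k,
    (X 0) ^ k * (X 1) ^ l]

/-- The formal partial derivative `∂F/∂s` evaluated at `(s, t)`. -/
noncomputable def Fds (k l : ℕ) (s t : ℂ) : Fin 4 → ℂ :=
  fun i => eval ![s, t] (pderiv (0 : Fin 2) (Fcoords k l i))

/-- The formal partial derivative `∂F/∂t` evaluated at `(s, t)`. -/
noncomputable def Fdt (k l : ℕ) (s t : ℂ) : Fin 4 → ℂ :=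
  fun i => eval ![s, t] (pderiv (1 : Fin 2) (Fcoords k l i))

/-- The family (2.2) consists of contact (legendrian) curves: for coprime positive
integers `k, l`, `ω(∂F/∂s, ∂F/∂t) = 0` at every point, and consequently `ω` vanishes
identically on the span of the two partial-derivative vectors. -/
theorem contact_family (k l : ℕ) (hk : 0 < k) (hl : 0 < l) (hkl : Nat.Coprime k l) :
    ∀ s t : ℂ,
      omegaForm (Fds k l s t) (Fdt k l s t) = 0 ∧
      ∀ u ∈ Submodule.span ℂ ({Fds k l s t, Fdt k l s t} : Set (Fin 4 → ℂ)),
      ∀ v ∈ Submodule.span ℂ ({Fds k l s t, Fdt k l s t} : Set (Fin 4 → ℂ)),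
        omegaForm u v = 0 := by
  intro s t
  have key : omegaForm (Fds k l s t) (Fdt k l s t) = 0 := by
    obtain ⟨a, rfl⟩ : ∃ a, k = a + 1 := ⟨k - 1, by omega⟩
    obtain ⟨b, rfl⟩ : ∃ b, l = b + 1 := ⟨l - 1, by omega⟩
    have hne : ((a : ℂ) + 1) + ((b : ℂ) + 1) ≠ 0 := by
      have h : ((a + 1 + (b + 1) : ℕ) : ℂ) ≠ 0 := Nat.cast_ne_zero.mpr (by omega)
      push_cast at h
      exact h
    have e : a + 1 + (b + 1) - 1 = a + b + 1 := by omega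
    simp [omegaForm, Fds, Fdt, Fcoords, Derivation.leibniz, Derivation.leibniz_pow,
      pderiv_X, e]
    field_simp
    ring
  refine ⟨key, ?_⟩
  intro u hu v hv
  obtain ⟨a, b, rfl⟩ := Submodule.mem_span_pair.mp hu
  obtain ⟨c, d, rfl⟩ := Submodule.mem_span_pair.mp hv
  simp only [omegaForm, Pi.add_apply, Pi.smul_apply, smul_eq_mul] at key ⊢
  linear_combination (a * d - b * c) * key
end

section
/- Let p₀, p₁, p₂, p₃ ∈ ℂ[X] satisfy the contact equation p₁'·p₀ − p₁·p₀' = p₂'·p₃ − p₂·p₃' in ℂ[X]. Then for every a ∈ ℂ, the polynomial G_a(X) = p₀(a)·p₁ − p₁(a)·p₀ + p₂(a)·p₃ − p₃(a)·p₂ is divisible by (X − a)³ in ℂ[X]. In other words, a contact curve in ℙ³ is osculating to the contact distribution: the contact plane at each point of the curve meets the curve with intersection multiplicity at least 3 at that point. -/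
open Polynomial

/-- A contact curve in `ℙ³` osculates the contact distribution (Corollary 2.3.2):
if the contact equation `p₁'·p₀ − p₁·p₀' = p₂'·p₃ − p₂·p₃'` holds, then for every
`a ∈ ℂ` the polynomial `G_a = p₀(a)·p₁ − p₁(a)·p₀ + p₂(a)·p₃ − p₃(a)·p₂`, cutting out
the intersection of the curve with its contact plane at the point of parameter `a`,
is divisible by `(X − a)³`. -/
theorem contact_osculates (p₀ p₁ p₂ p₃ : Polynomial ℂ)
    (h : p₁.derivative * p₀ - p₁ * p₀.derivative
        = p₂.derivative * p₃ - p₂ * p₃.derivative) :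
    ∀ a : ℂ,
      (X - C a) ^ 3 ∣
        (C (p₀.eval a) * p₁ - C (p₁.eval a) * p₀ +
          C (p₂.eval a) * p₃ - C (p₃.eval a) * p₂) := by
  intro a
  have h1 := congrArg (eval a) h
  have h2 := congrArg (fun q => eval a (derivative q)) h
  simp only [derivative_sub, derivative_mul, eval_sub, eval_add, eval_mul] at h1 h2
  generalize hG : C (p₀.eval a) * p₁ - C (p₁.eval a) * p₀ +
    C (p₂.eval a) * p₃ - C (p₃.eval a) * p₂ = G
  by_cases h0 : G = 0
  · rw [h0]
    exact dvd_zero _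
  refine (le_rootMultiplicity_iff h0).1 ?_
  refine Nat.succ_le_of_lt ((lt_rootMultiplicity_iff_isRoot_iterate_derivative h0).2 ?_)
  intro m hm
  subst hG
  interval_cases m
  · simp [IsRoot]
    ring
  · simp [IsRoot]
    linear_combination h1
  · simp [IsRoot]
    linear_combination h2
end

section
/- Let λ₀, λ₁, λ₂, λ₃ ∈ ℂ be pairwise distinct. Then the sum over the six two-element subsets {i, j} of {0, 1, 2, 3}, with {k, l} denoting the complementary two-element subset, of (λᵢ + λⱼ)⁴ / ((λᵢ − λₖ)(λᵢ − λₗ)(λⱼ − λₖ)(λⱼ − λₗ)), equals 2. -/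
/-- Bott localization computation of the contact-line invariant `N₁ = 2`: for pairwise
distinct weights `λ₀, λ₁, λ₂, λ₃`, the sum over the six two-element subsets `{i, j}` of
`{0, 1, 2, 3}` (with complementary subset `{k, l}`) of
`(λᵢ + λⱼ)⁴ / ((λᵢ − λₖ)(λᵢ − λₗ)(λⱼ − λₖ)(λⱼ − λₗ))` equals `2`,
the number of contact lines in `ℙ³` meeting 3 general lines. -/
theorem contact_lines_localization (l₀ l₁ l₂ l₃ : ℂ)
    (h01 : l₀ ≠ l₁) (h02 : l₀ ≠ l₂) (h03 : l₀ ≠ l₃)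
    (h12 : l₁ ≠ l₂) (h13 : l₁ ≠ l₃) (h23 : l₂ ≠ l₃) :
    (l₀ + l₁) ^ 4 / ((l₀ - l₂) * (l₀ - l₃) * (l₁ - l₂) * (l₁ - l₃)) +
    (l₀ + l₂) ^ 4 / ((l₀ - l₁) * (l₀ - l₃) * (l₂ - l₁) * (l₂ - l₃)) +
    (l₀ + l₃) ^ 4 / ((l₀ - l₁) * (l₀ - l₂) * (l₃ - l₁) * (l₃ - l₂)) +
    (l₁ + l₂) ^ 4 / ((l₁ - l₀) * (l₁ - l₃) * (l₂ - l₀) * (l₂ - l₃)) +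
    (l₁ + l₃) ^ 4 / ((l₁ - l₀) * (l₁ - l₂) * (l₃ - l₀) * (l₃ - l₂)) +
    (l₂ + l₃) ^ 4 / ((l₂ - l₀) * (l₂ - l₁) * (l₃ - l₀) * (l₃ - l₁)) = 2 := by
  have d01 : l₀ - l₁ ≠ 0 := sub_ne_zero.mpr h01
  have d02 : l₀ - l₂ ≠ 0 := sub_ne_zero.mpr h02
  have d03 : l₀ - l₃ ≠ 0 := sub_ne_zero.mpr h03
  have d12 : l₁ - l₂ ≠ 0 := sub_ne_zero.mpr h12
  have d13 : l₁ - l₃ ≠ 0 := sub_ne_zero.mpr h13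
  have d23 : l₂ - l₃ ≠ 0 := sub_ne_zero.mpr h23
  rw [← neg_sub l₀ l₁, ← neg_sub l₀ l₂, ← neg_sub l₀ l₃, ← neg_sub l₁ l₂, ← neg_sub l₁ l₃, ← neg_sub l₂ l₃]
  field_simp
  ring
end
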